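/- arXiv:2401.03937 — 3 statements merged into one kernel-verified Lean document; each statement's English description precedes it below -/
import Mathlib

section
/- Hitting-time tail for a lazy symmetric walk driven by an (M1)-chain: Let S be countable and let (Y_k, W_k)_{k≥0} satisfy property (M1) with W_k taking values in {−1,0,1}, and suppose there is α ∈ (0,1/2] such that for every x ∈ S and every k ≥ 0, conditionally on Y_k = x, the increment W_{k+1} has a symmetric distribution on {−1,0,1} with P[W_{k+1} = 1 | Y_k = x] ≥ α. Set Z_0 := 0 and Z_k := W_1 + ⋯ + W_k, and for an integer A ≥ 1 let τ_A := inf{k ≥ 0 : Z_k = A}. Then there exists a universal constant C' > 0 such that for every starting state u ∈ S and all integers A ≥ 1 and k ≥ 1: P_u[τ_A > k] ≤ C'·A/√(αk) + 2(1−2α)/(αk). -/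
open MeasureTheory Finset
open scoped ENNReal Classical

noncomputable section

/-- Property (M1) for a pair process `(Y_k, W_k)` with `ℤ`-valued second coordinate:
conditionally on the history `(Y_0, W_0, …, Y_{k−1}, W_{k−1})`, the pair
`(Y_k, W_k)` has law `κ(Y_{k−1}, ·)`. -/
def M1Pair {S : Type*} {Ω : Type*} [MeasurableSpace Ω] (μ : Measure Ω)
    (Y : ℕ → Ω → S) (W : ℕ → Ω → ℤ) (κ : S → S → ℤ → ℝ≥0∞) : Prop :=
  ∀ k : ℕ, 1 ≤ k → ∀ (ys : ℕ → S) (ws : ℕ → ℤ) (y : S) (w : ℤ),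
    μ ({ω | ∀ i < k, Y i ω = ys i ∧ W i ω = ws i} ∩
        {ω | Y k ω = y ∧ W k ω = w}) =
      κ (ys (k - 1)) y w * μ {ω | ∀ i < k, Y i ω = ys i ∧ W i ω = ws i}

section KernelLemmas

variable {S : Type*} {κ : S → S → ℤ → ℝ≥0∞}

/-- The step law of a kernel supported on steps in `{-1, 0, 1}` has total mass one. -/
lemma step_law_total (hsum : ∀ x, ∑' p : S × ℤ, κ x p.1 p.2 = 1)
    (hsupp : ∀ x y t, 1 < |t| → κ x y t = 0) (x : S) :
    ∑' y, κ x y (-1) + (∑' y, κ x y 0 + ∑' y, κ x y 1) = 1 := by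
  rw [← hsum x, ENNReal.tsum_prod, ENNReal.tsum_comm,
    tsum_eq_sum (s := ({-1, 0, 1} : Finset ℤ))]
  · simp
  · intro t ht
    refine ENNReal.tsum_eq_zero.2 fun y => hsupp x y t ?_
    by_contra! h
    rw [abs_le] at h
    simp only [Finset.mem_insert, Finset.mem_singleton, not_or] at ht
    omega

/-- Lower bound on the moment generating function of a symmetric step in `{-1, 0, 1}`. -/
lemma step_mgf_lower_bound {a b p : ℝ≥0∞} {α θ : ℝ} (hα : 0 ≤ α) (htot : a + (b + p) = 1)
    (hsymm : p = a) (hp : ENNReal.ofReal α ≤ p) :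
    ENNReal.ofReal (1 + α * θ ^ 2) ≤
      ENNReal.ofReal (Real.exp (-θ)) * a + (b + ENNReal.ofReal (Real.exp θ) * p) := by
  subst hsymm
  have hp1 : p ≠ ⊤ := by rintro rfl; simp at htot
  have hb1 : b ≠ ⊤ := by rintro rfl; simp at htot
  lift p to NNReal using hp1
  lift b to NNReal using hb1
  have htot' : (p : ℝ) + (b + p) = 1 := by exact_mod_cast htot
  have hp' : α ≤ p := by
    have := ENNReal.toReal_mono ENNReal.coe_ne_top hp
    rwa [ENNReal.toReal_ofReal hα] at this
  have hcosh : 2 + θ ^ 2 ≤ Real.exp θ + Real.exp (-θ) := by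
    have hsinh : |θ / 2| ≤ |Real.sinh (θ / 2)| := by
      rw [Real.abs_sinh]
      exact Real.self_le_sinh_iff.2 (abs_nonneg _)
    have hcosh_half := Real.cosh_two_mul (θ / 2)
    rw [Real.cosh_sq, mul_div_cancel₀ θ two_ne_zero, Real.cosh_eq] at hcosh_half
    linarith [sq_le_sq.2 hsinh]
  rw [← ENNReal.ofReal_coe_nnreal, ← ENNReal.ofReal_coe_nnreal, ← ENNReal.ofReal_mul (by positivity),
    ← ENNReal.ofReal_mul (by positivity), ← ENNReal.ofReal_add (by positivity) (by positivity),
    ← ENNReal.ofReal_add (by positivity) (by positivity)]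
  refine ENNReal.ofReal_le_ofReal ?_
  nlinarith [mul_le_mul_of_nonneg_left hcosh p.2, mul_le_mul_of_nonneg_right hp' (sq_nonneg θ)]

end KernelLemmas

/-- The history of the pair process strictly before time `k`. -/
def pairHistory {S Ω : Type*} (Y : ℕ → Ω → S) (W : ℕ → Ω → ℤ) (k : ℕ) (ω : Ω) : Fin k → S × ℤ :=
  fun i => (Y i ω, W i ω)

lemma pairHistory_preimage_singleton {S Ω : Type*} (Y : ℕ → Ω → S) (W : ℕ → Ω → ℤ)
    (k : ℕ) (ω₀ : Ω) :
    pairHistory Y W k ⁻¹' {pairHistory Y W k ω₀} =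
      {ω | ∀ i < k, Y i ω = Y i ω₀ ∧ W i ω = W i ω₀} := by
  ext ω
  simp [pairHistory, funext_iff, Fin.forall_iff]

lemma measurable_pairHistory {S Ω : Type*} [MeasurableSpace S] [MeasurableSpace Ω]
    {Y : ℕ → Ω → S} {W : ℕ → Ω → ℤ} (hY : ∀ k, Measurable (Y k))
    (hW : ∀ k, Measurable (W k)) (k : ℕ) :
    Measurable (pairHistory Y W k) :=
  measurable_pi_lambda _ fun i => (hY i).prodMk (hW i)

section PairChain

variable {S Ω : Type*} [Countable S] [MeasurableSpace S] [MeasurableSingletonClass S]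
  [MeasurableSpace Ω] {μ : Measure Ω} {Y : ℕ → Ω → S} {W : ℕ → Ω → ℤ} {κ : S → S → ℤ → ℝ≥0∞}

/-- The law of the step at time `k` on a cylinder set of the history before `k`. -/
lemma M1Pair.measure_history_inter_step (hM : M1Pair μ Y W κ) (hY : ∀ k, Measurable (Y k))
    (hW : ∀ k, Measurable (W k)) {k : ℕ} (hk : 1 ≤ k) (ys : ℕ → S) (ws : ℕ → ℤ) (w : ℤ) :
    μ ({ω | ∀ i < k, Y i ω = ys i ∧ W i ω = ws i} ∩ {ω | W k ω = w}) =
      (∑' y, κ (ys (k - 1)) y w) * μ {ω | ∀ i < k, Y i ω = ys i ∧ W i ω = ws i} := by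
  have hset : {ω | ∀ i < k, Y i ω = ys i ∧ W i ω = ws i} ∩ {ω | W k ω = w} =
      ⋃ y, ({ω | ∀ i < k, Y i ω = ys i ∧ W i ω = ws i} ∩ {ω | Y k ω = y ∧ W k ω = w}) := by
    ext ω
    simp
  have hF : MeasurableSet {ω | ∀ i < k, Y i ω = ys i ∧ W i ω = ws i} := by
    measurability
  rw [hset, measure_iUnion, ← ENNReal.tsum_mul_right]
  · exact tsum_congr fun y => hM k hk ys ws y w
  · intro y y' hyy'
    refine Set.disjoint_left.2 ?_
    rintro ω ⟨-, h, -⟩ ⟨-, h', -⟩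
    exact hyy' (h.symm.trans h')
  · intro y
    exact hF.inter ((hY k (measurableSet_singleton y)).inter (hW k (measurableSet_singleton w)))

/-- The steps of the walk have absolute value at most one almost surely. -/
lemma M1Pair.ae_abs_step_le_one (hM : M1Pair μ Y W κ) (hY : ∀ k, Measurable (Y k))
    (hW : ∀ k, Measurable (W k)) (hsupp : ∀ x y t, 1 < |t| → κ x y t = 0) :
    ∀ᵐ ω ∂μ, ∀ i, |W (i + 1) ω| ≤ 1 := by
  refine ae_all_iff.2 fun i => ?_
  have key : ∀ (h : Fin (i + 1) → S × ℤ) (t : ℤ), 1 < |t| →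
      μ (pairHistory Y W (i + 1) ⁻¹' {h} ∩ {ω | W (i + 1) ω = t}) = 0 := by
    intro h t ht
    rcases Set.eq_empty_or_nonempty (pairHistory Y W (i + 1) ⁻¹' {h}) with he | ⟨ω₀, rfl⟩
    · simp [he]
    · rw [pairHistory_preimage_singleton, hM.measure_history_inter_step hY hW (by omega)]
      simp [hsupp _ _ t ht]
  have key' : ∀ᵐ ω ∂μ, ∀ (h : Fin (i + 1) → S × ℤ) (t : ℤ), 1 < |t| →
      ¬ (pairHistory Y W (i + 1) ω = h ∧ W (i + 1) ω = t) := by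
    refine ae_all_iff.2 fun h => ae_all_iff.2 fun t => ?_
    by_cases ht : 1 < |t|
    · filter_upwards [measure_eq_zero_iff_ae_notMem.1 (key h t ht)] with ω hω _ using hω
    · exact Filter.Eventually.of_forall fun ω h => absurd h ht
  filter_upwards [key'] with ω hω
  by_contra! h
  exact hω _ _ h ⟨rfl, rfl⟩

/-- Multiplying a functional of the past by the exponential of the next step increases its
integral at least by the factor `1 + α θ²`. -/
lemma M1Pair.mul_lintegral_le_lintegral_mul_exp (hM : M1Pair μ Y W κ)
    (hY : ∀ k, Measurable (Y k)) (hW : ∀ k, Measurable (W k)) {α θ : ℝ} (hα : 0 ≤ α)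
    (hsum : ∀ x, ∑' p : S × ℤ, κ x p.1 p.2 = 1)
    (hsupp : ∀ x y t, 1 < |t| → κ x y t = 0)
    (hsymm : ∀ x, ∑' y, κ x y 1 = ∑' y, κ x y (-1))
    (hlow : ∀ x, ENNReal.ofReal α ≤ ∑' y, κ x y 1) {k : ℕ} (hk : 1 ≤ k) (G : Ω → ℝ≥0∞)
    (hG : ∀ ω ω', (∀ i < k, Y i ω = Y i ω' ∧ W i ω = W i ω') → G ω = G ω') :
    ENNReal.ofReal (1 + α * θ ^ 2) * ∫⁻ ω, G ω ∂μ ≤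
      ∫⁻ ω, G ω * ENNReal.ofReal (Real.exp (θ * W k ω)) ∂μ := by
  have hexp : Measurable fun t : ℤ => ENNReal.ofReal (Real.exp (θ * t)) := measurable_of_countable _
  have hexpW : Measurable fun ω => ENNReal.ofReal (Real.exp (θ * W k ω)) := hexp.comp (hW k)
  have hmeas : ∀ h, MeasurableSet (pairHistory Y W k ⁻¹' {h}) := fun h =>
    measurable_pairHistory hY hW k (measurableSet_singleton h)
  have hsplit : ∀ f : Ω → ℝ≥0∞,
      ∫⁻ ω, f ω ∂μ = ∑' h, ∫⁻ ω in pairHistory Y W k ⁻¹' {h}, f ω ∂μ := by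
    intro f
    rw [← lintegral_iUnion hmeas, ← Set.preimage_iUnion, Set.iUnion_of_singleton,
      Set.preimage_univ, Measure.restrict_univ]
    intro h h' hh
    exact Disjoint.preimage _ (Set.disjoint_singleton.2 hh)
  rw [hsplit, hsplit, ← ENNReal.tsum_mul_left]
  refine ENNReal.tsum_le_tsum fun h => ?_
  rcases Set.eq_empty_or_nonempty (pairHistory Y W k ⁻¹' {h}) with he | ⟨ω₀, rfl⟩
  · simp [he]
  have hmF := hmeas (pairHistory Y W k ω₀)
  rw [pairHistory_preimage_singleton] at hmF ⊢
  set F := {ω | ∀ i < k, Y i ω = Y i ω₀ ∧ W i ω = W i ω₀}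
  have hGF : ∀ ω ∈ F, G ω = G ω₀ := fun ω hω => hG _ _ hω
  have hGexp : Set.EqOn (fun ω => G ω * ENNReal.ofReal (Real.exp (θ * W k ω)))
      (fun ω => G ω₀ * ENNReal.ofReal (Real.exp (θ * W k ω))) F := fun ω hω => by
    simp only [hGF ω hω]
  rw [setLIntegral_congr_fun (g := fun _ => G ω₀) hmF hGF, setLIntegral_congr_fun hmF hGexp,
    setLIntegral_const, lintegral_const_mul _ hexpW, mul_left_comm]
  gcongr
  have hstep : ∀ t : ℤ, (μ.restrict F).map (W k) {t} =
      (∑' y, κ (Y (k - 1) ω₀) y t) * μ F := by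
    intro t
    rw [Measure.map_apply (hW k) (measurableSet_singleton t),
      Measure.restrict_apply (hW k (measurableSet_singleton t)), Set.inter_comm]
    exact hM.measure_history_inter_step hY hW hk (fun i => Y i ω₀) (fun i => W i ω₀) t
  rw [← lintegral_map hexp (hW k), lintegral_countable']
  refine le_trans ?_ (ENNReal.sum_le_tsum ({-1, 0, 1} : Finset ℤ))
  simp only [hstep]
  refine (mul_le_mul_left (step_mgf_lower_bound (θ := θ) hα (step_law_total hsum hsupp _)
    (hsymm (Y (k - 1) ω₀)) (hlow _)) (μ F)).trans (le_of_eq ?_)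
  simp [add_mul, mul_assoc]

end PairChain

/-- A skip-free integer walk that avoids the level `A ≥ 1` up to time `k` stays below it. -/
lemma sum_range_lt_of_forall_ne {w : ℕ → ℤ} (hw : ∀ i, |w i| ≤ 1) {A : ℤ} (hA : 1 ≤ A) {k : ℕ}
    (h : ∀ m ≤ k, ∑ i ∈ range m, w i ≠ A) : ∑ i ∈ range k, w i < A := by
  induction k with
  | zero => simp; omega
  | succ k ih =>
    have h1 := ih fun m hm => h m (by omega)
    have h2 := h (k + 1) le_rfl
    have h3 := (abs_le.1 (hw k)).2
    rw [sum_range_succ] at h2 ⊢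
    omega

/-- If `a` is a decreasing survival probability, and `d ≤ a` grows by a factor `l` up to the
mass lost by `a`, then `a` is controlled by `1 - d 0`. -/
lemma survival_mul_le {a d : ℕ → ℝ} {l : ℝ} (hl : 1 ≤ l) (ha0 : a 0 = 1)
    (ha : ∀ k, a (k + 1) ≤ a k) (hda : ∀ k, d k ≤ a k)
    (hstep : ∀ k, l * d k ≤ d (k + 1) + (a k - a (k + 1))) (k : ℕ) :
    a k * (1 - (l ^ k)⁻¹) ≤ 1 - d 0 := by
  have hl0 : 0 < l := by linarith
  have key : ∀ k, d 0 ≤ d k * (l ^ k)⁻¹ + (1 - a k) := by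
    intro k
    induction k with
    | zero => simp [ha0]
    | succ k ih =>
      have hinv : (l ^ k)⁻¹ = l * (l ^ (k + 1))⁻¹ := by
        field_simp
        ring
      have hle : (l ^ (k + 1))⁻¹ ≤ 1 := inv_le_one_of_one_le₀ (one_le_pow₀ hl)
      have hpos : 0 ≤ (l ^ (k + 1))⁻¹ := by positivity
      rw [hinv] at ih
      nlinarith [mul_le_mul_of_nonneg_right (hstep k) hpos,
        mul_nonneg (sub_nonneg.2 (ha k)) (sub_nonneg.2 hle)]
  have hpos : 0 ≤ (l ^ k)⁻¹ := by positivity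
  nlinarith [key k, mul_le_mul_of_nonneg_right (hda k) hpos]

/-- Hitting-time tail for a lazy symmetric walk driven by an (M1) chain
(from the proof of Proposition 5.4). -/
theorem lazy_symmetric_walk_hitting_tail :
    ∃ C' : ℝ, 0 < C' ∧
    ∀ (S : Type) [Countable S] [MeasurableSpace S] [MeasurableSingletonClass S]
      (Ω : Type) [MeasurableSpace Ω] (μ : Measure Ω) (_ : IsProbabilityMeasure μ)
      (Y : ℕ → Ω → S) (W : ℕ → Ω → ℤ) (κ : S → S → ℤ → ℝ≥0∞) (α : ℝ),
      (∀ k, Measurable (Y k)) → (∀ k, Measurable (W k)) →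
      0 < α → α ≤ 1 / 2 →
      (∀ x, ∑' (p : S × ℤ), κ x p.1 p.2 = 1) →
      (∀ x y t, 1 < |t| → κ x y t = 0) →
      (∀ x, ∑' y, κ x y 1 = ∑' y, κ x y (-1)) →
      (∀ x, ENNReal.ofReal α ≤ ∑' y, κ x y 1) →
      M1Pair μ Y W κ →
      ∀ u : S, (∀ᵐ ω ∂μ, Y 0 ω = u) →
      ∀ A k : ℕ, 1 ≤ A → 1 ≤ k →
        (μ {ω | ∀ m ≤ k, (∑ i ∈ range m, W (i + 1) ω) ≠ (A : ℤ)}).toReal ≤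
          C' * (A : ℝ) / Real.sqrt (α * (k : ℝ)) + 2 * (1 - 2 * α) / (α * (k : ℝ)) := by
  refine ⟨2, two_pos, ?_⟩
  intro S _ _ _ Ω _ μ _ Y W κ α hY hW hα hα2 hsum hsupp hsymm hlow hM u _ A k hA hk
  have hk0 : (0 : ℝ) < k := by exact_mod_cast hk
  have hA' : (1 : ℤ) ≤ A := by exact_mod_cast hA
  set θ : ℝ := 1 / Real.sqrt (α * k) with hθ
  have hθ0 : 0 < θ := by positivity
  have hθ2 : α * θ ^ 2 = 1 / k := by
    rw [hθ, div_pow, Real.sq_sqrt (by positivity)]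
    field_simp
  set Z : ℕ → Ω → ℤ := fun m ω => ∑ i ∈ range m, W (i + 1) ω with hZ
  have hZm : ∀ m, Measurable (Z m) := fun m =>
    Finset.measurable_sum _ fun i _ => hW (i + 1)
  have hZs : ∀ m ω, Z (m + 1) ω = Z m ω + W (m + 1) ω := fun m ω => sum_range_succ _ _
  set E : ℕ → Set Ω := fun n => {ω | ∀ m ≤ n, Z m ω ≠ A} with hE
  have hEm : ∀ n, MeasurableSet (E n) := fun n => by
    simp only [hE, Set.ofPred_forall]
    exact MeasurableSet.iInter fun m => MeasurableSet.iInter fun _ =>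
      (hZm m (measurableSet_singleton _)).compl
  have hEs : ∀ n, E (n + 1) ⊆ E n := fun n ω hω m hm => hω m (by omega)
  have hexp : ∀ n, Measurable fun ω => ENNReal.ofReal (Real.exp (θ * Z n ω)) := fun n =>
    (measurable_of_countable fun t : ℤ => ENNReal.ofReal (Real.exp (θ * t))).comp (hZm n)
  set B : ℕ → ℝ≥0∞ := fun n => ∫⁻ ω in E n, ENNReal.ofReal (Real.exp (θ * Z n ω)) ∂μ with hB
  set c : ℝ := Real.exp (θ * A) with hc
  have hc0 : 0 < c := Real.exp_pos _
  have hsteps := hM.ae_abs_step_le_one hY hW hsupp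
  have hlt : ∀ᵐ ω ∂μ, ∀ n, ω ∈ E n → Z n ω < A := by
    filter_upwards [hsteps] with ω hω n hn
    exact sum_range_lt_of_forall_ne hω hA' hn
  have hBle : ∀ n, B n ≤ ENNReal.ofReal c * μ (E n) := by
    intro n
    rw [← setLIntegral_const]
    refine lintegral_mono_ae ((ae_restrict_iff' (hEm n)).2 ?_)
    filter_upwards [hlt] with ω hω hn
    have : (Z n ω : ℝ) ≤ A := by exact_mod_cast (hω n hn).le
    refine ENNReal.ofReal_le_ofReal (Real.exp_le_exp.2 ?_)
    gcongr
  have hBtop : ∀ n, B n ≠ ⊤ := fun n =>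
    ne_top_of_le_ne_top (ENNReal.mul_ne_top ENNReal.ofReal_ne_top (measure_ne_top _ _)) (hBle n)
  have hBstep : ∀ n, ENNReal.ofReal (1 + α * θ ^ 2) * B n ≤
      B (n + 1) + ENNReal.ofReal c * μ (E n \ E (n + 1)) := by
    intro n
    have h1 := hM.mul_lintegral_le_lintegral_mul_exp hY hW (θ := θ) hα.le hsum hsupp hsymm hlow
      (k := n + 1) (by omega) ((E n).indicator fun ω => ENNReal.ofReal (Real.exp (θ * Z n ω))) (by
        intro ω ω' h
        have hZeq : ∀ m ≤ n, Z m ω = Z m ω' := fun m hm =>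
          sum_congr rfl fun i hi => (h (i + 1) (by have := mem_range.1 hi; omega)).2
        have hEeq : ω ∈ E n ↔ ω' ∈ E n :=
          forall₂_congr fun m hm => by rw [hZeq m hm]
        simp only [Set.indicator_apply, hEeq, hZeq n le_rfl])
    rw [lintegral_indicator (hEm n)] at h1
    refine h1.trans ?_
    have h2 : ∀ ω, (E n).indicator (fun ω => ENNReal.ofReal (Real.exp (θ * Z n ω))) ω *
        ENNReal.ofReal (Real.exp (θ * W (n + 1) ω)) =
        (E n).indicator (fun ω => ENNReal.ofReal (Real.exp (θ * Z (n + 1) ω))) ω := by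
      intro ω
      by_cases hω : ω ∈ E n
      · simp only [Set.indicator_of_mem hω, hZs]
        rw [← ENNReal.ofReal_mul (Real.exp_pos _).le, ← Real.exp_add]
        push_cast
        ring_nf
      · simp [Set.indicator_of_notMem hω]
    simp only [h2]
    rw [lintegral_indicator (hEm n), ← lintegral_inter_add_sdiff _ _ (hEm (n + 1)),
      Set.inter_eq_self_of_subset_right (hEs n)]
    gcongr
    rw [← setLIntegral_const]
    refine setLIntegral_mono measurable_const fun ω hω => ?_
    have hZA : Z (n + 1) ω = A := by
      by_contra hne
      refine hω.2 fun m hm => ?_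
      rcases Nat.lt_or_eq_of_le hm with hm | rfl
      · exact hω.1 m (by omega)
      · exact hne
    rw [hZA, hc]
    simp
  have hE0 : E 0 = Set.univ := by
    refine Set.eq_univ_of_forall fun ω m hm => ?_
    obtain rfl := Nat.le_zero.1 hm
    simp only [hZ, range_zero, sum_empty]
    omega
  have hB0 : B 0 = 1 := by
    simp [hB, hE0, hZ]
  have hl : 1 ≤ 1 + α * θ ^ 2 := by
    have : 0 ≤ α * θ ^ 2 := by positivity
    linarith
  have hmain := survival_mul_le (a := fun n => μ.real (E n)) (d := fun n => (B n).toReal / c)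
    (l := 1 + α * θ ^ 2) hl (by simp [hE0]) (fun n => measureReal_mono (hEs n))
    (fun n => by
      rw [div_le_iff₀ hc0]
      have := ENNReal.toReal_mono
        (ENNReal.mul_ne_top ENNReal.ofReal_ne_top (measure_ne_top _ _)) (hBle n)
      rw [ENNReal.toReal_mul, ENNReal.toReal_ofReal hc0.le] at this
      simpa [Measure.real, mul_comm] using this)
    (fun n => by
      have hfin : ENNReal.ofReal c * μ (E n \ E (n + 1)) ≠ ⊤ :=
        ENNReal.mul_ne_top ENNReal.ofReal_ne_top (measure_ne_top _ _)
      have := ENNReal.toReal_mono (ENNReal.add_ne_top.2 ⟨hBtop (n + 1), hfin⟩) (hBstep n)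
      rw [ENNReal.toReal_add (hBtop _) hfin, ENNReal.toReal_mul, ENNReal.toReal_mul,
        ENNReal.toReal_ofReal hc0.le, ENNReal.toReal_ofReal (by linarith),
        ← Measure.real, measureReal_sdiff (hEs n) (hEm (n + 1))] at this
      rw [← mul_div_assoc, div_add' _ _ _ hc0.ne']
      gcongr
      linarith) k
  have hpow : (2 : ℝ) ≤ (1 + α * θ ^ 2) ^ k := by
    have := one_add_mul_le_pow (a := α * θ ^ 2) (by linarith) k
    rw [hθ2, mul_one_div_cancel hk0.ne', ← hθ2] at this
    linarith
  have hinv : ((1 + α * θ ^ 2) ^ k)⁻¹ ≤ 2⁻¹ := inv_anti₀ two_pos hpow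
  have hd0 : 1 - (B 0).toReal / c ≤ θ * A := by
    rw [hB0, hc, ENNReal.toReal_one, one_div, ← Real.exp_neg]
    linarith [Real.add_one_le_exp (-(θ * A))]
  have hfinal : μ.real (E k) ≤ 2 * (A : ℝ) / Real.sqrt (α * k) := by
    have hge : μ.real (E k) * 2⁻¹ ≤ θ * A :=
      (mul_le_mul_of_nonneg_left (by linarith) measureReal_nonneg).trans (hmain.trans hd0)
    have : 2 * (A : ℝ) / Real.sqrt (α * k) = 2 * (θ * A) := by
      rw [hθ]
      ring
    rw [this]
    linarith
  have hextra : 0 ≤ 2 * (1 - 2 * α) / (α * (k : ℝ)) :=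
    div_nonneg (by linarith) (by positivity)
  exact hfinal.trans (by linarith)
end
end

section
/- Almost sure increment bound under a random transposition: Let φ be a multilinear polynomial in the indeterminates X_{ij}, i,j ∈ [n], with non-negative coefficients. Then for every permutation σ of [n] and every transposition τ (or τ the identity): if φ has degree 1 then |φ(σ) − φ(στ)| ≤ 2‖∇φ‖_∞, and in general |φ(σ) − φ(στ)| ≤ 6‖∇φ‖_∞. -/
open MvPolynomial

noncomputable section

/-- The permutation matrix of `σ`, as an assignment of values to the indeterminates `X_{ij}`. -/
def permMat (n : ℕ) (σ : Equiv.Perm (Fin n)) : Fin n × Fin n → ℝ :=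
  fun p => if σ p.1 = p.2 then 1 else 0

/-- Evaluation of a polynomial in the indeterminates `X_{ij}` at the permutation matrix of `σ`. -/
def permEval (n : ℕ) (φ : MvPolynomial (Fin n × Fin n) ℝ) (σ : Equiv.Perm (Fin n)) : ℝ :=
  eval (permMat n σ) φ

/-- Multilinearity: `∂_{ij}∂_{ik} φ ≡ 0` and `∂_{ji}∂_{ki} φ ≡ 0` for all `i, j, k`. -/
def IsMultilinear (n : ℕ) (φ : MvPolynomial (Fin n × Fin n) ℝ) : Prop :=
  ∀ i j k : Fin n,
    pderiv (i, j) (pderiv (i, k) φ) = 0 ∧ pderiv (j, i) (pderiv (k, i) φ) = 0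

/-- `‖∇φ‖_∞ = max_σ max_{i,j} |∂_{ij}φ(σ)|`. -/
def gradNorm (n : ℕ) (φ : MvPolynomial (Fin n × Fin n) ℝ) : ℝ :=
  ⨆ σ : Equiv.Perm (Fin n), ⨆ q : Fin n × Fin n, |permEval n (pderiv q φ) σ|

theorem permMat_nonneg (n : ℕ) (σ : Equiv.Perm (Fin n)) (p : Fin n × Fin n) :
    0 ≤ permMat n σ p := by
  unfold permMat
  split_ifs <;> norm_num

theorem permMat_le_one (n : ℕ) (σ : Equiv.Perm (Fin n)) (p : Fin n × Fin n) :
    permMat n σ p ≤ 1 := by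
  unfold permMat
  split_ifs <;> norm_num

theorem permEval_eq_sum (n : ℕ) (φ : MvPolynomial (Fin n × Fin n) ℝ)
    (σ : Equiv.Perm (Fin n)) :
    permEval n φ σ = ∑ m ∈ φ.support, φ.coeff m * m.prod fun p k => permMat n σ p ^ k := by
  rw [permEval, eval_eq]
  rfl

theorem permEval_pderiv_eq_sum (n : ℕ) (φ : MvPolynomial (Fin n × Fin n) ℝ)
    (σ : Equiv.Perm (Fin n)) (q : Fin n × Fin n) :
    permEval n (pderiv q φ) σ = ∑ m ∈ φ.support,
      φ.coeff m * (m q * (m - Finsupp.single q 1).prod fun p k => permMat n σ p ^ k) := by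
  conv_lhs => rw [permEval, φ.as_sum]
  simp only [map_sum, pderiv_monomial, eval_monomial, mul_assoc]

theorem monomial_permMat_nonneg (n : ℕ) (σ : Equiv.Perm (Fin n)) (m : Fin n × Fin n →₀ ℕ) :
    0 ≤ m.prod fun p k => permMat n σ p ^ k :=
  Finset.prod_nonneg fun p _ => pow_nonneg (permMat_nonneg n σ p) _

theorem monomial_permMat_le_one (n : ℕ) (σ : Equiv.Perm (Fin n)) (m : Fin n × Fin n →₀ ℕ) :
    m.prod (fun p k => permMat n σ p ^ k) ≤ 1 :=
  Finset.prod_le_one (fun p _ => pow_nonneg (permMat_nonneg n σ p) _)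
    fun p _ => pow_le_one₀ (permMat_nonneg n σ p) (permMat_le_one n σ p)

theorem monomial_permMat_eq_one (n : ℕ) (σ : Equiv.Perm (Fin n)) (m : Fin n × Fin n →₀ ℕ)
    (h : ∀ p, m p ≠ 0 → σ p.1 = p.2) :
    m.prod (fun p k => permMat n σ p ^ k) = 1 := by
  refine Finset.prod_eq_one fun p hp => ?_
  simp [permMat, h p (Finsupp.mem_support_iff.mp hp)]

theorem monomial_permMat_eq_zero (n : ℕ) (σ : Equiv.Perm (Fin n)) (m : Fin n × Fin n →₀ ℕ)
    (h : ¬ ∀ p, m p ≠ 0 → σ p.1 = p.2) :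
    m.prod (fun p k => permMat n σ p ^ k) = 0 := by
  push Not at h
  obtain ⟨p, hp, hσ⟩ := h
  refine Finset.prod_eq_zero (Finsupp.mem_support_iff.mpr hp) ?_
  simp [permMat, hσ, hp]

theorem one_le_pderiv_monomial_permMat (n : ℕ) (σ : Equiv.Perm (Fin n))
    (m : Fin n × Fin n →₀ ℕ) (h : ∀ p, m p ≠ 0 → σ p.1 = p.2) (q : Fin n × Fin n)
    (hq : m q ≠ 0) :
    1 ≤ (m q : ℝ) * (m - Finsupp.single q 1).prod fun p k => permMat n σ p ^ k := by
  rw [monomial_permMat_eq_one n σ (m - Finsupp.single q 1), mul_one]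
  · exact_mod_cast Nat.one_le_iff_ne_zero.mpr hq
  · intro p hp
    refine h p fun h0 => hp ?_
    simp [Finsupp.tsub_apply, h0]

/-- A monomial which survives at `σ` but not at `σ * swap i j` involves `(i, σ i)` or `(j, σ j)`. -/
theorem monomial_permMat_sub_le (n : ℕ) (σ : Equiv.Perm (Fin n)) (i j : Fin n)
    (m : Fin n × Fin n →₀ ℕ) :
    (m.prod fun p k => permMat n σ p ^ k)
        - (m.prod fun p k => permMat n (σ * Equiv.swap i j) p ^ k) ≤
      m (i, σ i) * ((m - Finsupp.single (i, σ i) 1).prod fun p k => permMat n σ p ^ k)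
        + m (j, σ j) * ((m - Finsupp.single (j, σ j) 1).prod fun p k => permMat n σ p ^ k) := by
  have hnn (q : Fin n × Fin n) :
      0 ≤ (m q : ℝ) * (m - Finsupp.single q 1).prod fun p k => permMat n σ p ^ k :=
    mul_nonneg (Nat.cast_nonneg _) (monomial_permMat_nonneg n σ _)
  have hi := hnn (i, σ i)
  have hj := hnn (j, σ j)
  have hτ := monomial_permMat_nonneg n (σ * Equiv.swap i j) m
  have hσ := monomial_permMat_le_one n σ m
  by_cases h : ∀ p, m p ≠ 0 → σ p.1 = p.2
  · by_cases hmi : m (i, σ i) = 0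
    · by_cases hmj : m (j, σ j) = 0
      · have hone := monomial_permMat_eq_one n (σ * Equiv.swap i j) m fun p hp => by
          have hpσ := h p hp
          have hpi : p.1 ≠ i := by
            rintro rfl
            rw [hpσ] at hmi
            exact hp hmi
          have hpj : p.1 ≠ j := by
            rintro rfl
            rw [hpσ] at hmj
            exact hp hmj
          rw [Equiv.Perm.mul_apply, Equiv.swap_apply_of_ne_of_ne hpi hpj, hpσ]
        linarith
      · linarith [one_le_pderiv_monomial_permMat n σ m h _ hmj]
    · linarith [one_le_pderiv_monomial_permMat n σ m h _ hmi]
  · linarith [monomial_permMat_eq_zero n σ m h]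

theorem abs_permEval_pderiv_le_gradNorm (n : ℕ) (φ : MvPolynomial (Fin n × Fin n) ℝ)
    (σ : Equiv.Perm (Fin n)) (q : Fin n × Fin n) :
    |permEval n (pderiv q φ) σ| ≤ gradNorm n φ :=
  (le_ciSup (f := fun q => |permEval n (pderiv q φ) σ|) (Set.finite_range _).bddAbove q).trans
    (le_ciSup (f := fun σ => ⨆ q, |permEval n (pderiv q φ) σ|) (Set.finite_range _).bddAbove σ)

theorem permEval_sub_le_two_mul_gradNorm (n : ℕ) (φ : MvPolynomial (Fin n × Fin n) ℝ)
    (hpos : ∀ m, 0 ≤ φ.coeff m) (σ : Equiv.Perm (Fin n)) (i j : Fin n) :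
    permEval n φ σ - permEval n φ (σ * Equiv.swap i j) ≤ 2 * gradNorm n φ := by
  have key : permEval n φ σ - permEval n φ (σ * Equiv.swap i j) ≤
      permEval n (pderiv (i, σ i) φ) σ + permEval n (pderiv (j, σ j) φ) σ := by
    rw [permEval_pderiv_eq_sum, permEval_pderiv_eq_sum, permEval_eq_sum, permEval_eq_sum]
    simp only [← Finset.sum_sub_distrib, ← Finset.sum_add_distrib, ← mul_sub, ← mul_add]
    exact Finset.sum_le_sum fun m _ =>
      mul_le_mul_of_nonneg_left (monomial_permMat_sub_le n σ i j m) (hpos m)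
  linarith [(le_abs_self _).trans (abs_permEval_pderiv_le_gradNorm n φ σ (i, σ i)),
    (le_abs_self _).trans (abs_permEval_pderiv_le_gradNorm n φ σ (j, σ j))]

/-- Lemma 9.4: almost sure bound on the increment of a multilinear function with
non-negative coefficients under a random transposition. -/
theorem increment_bound_transposition (n : ℕ) (hn : 1 ≤ n)
    (φ : MvPolynomial (Fin n × Fin n) ℝ)
    (hml : IsMultilinear n φ) (hpos : ∀ m, 0 ≤ φ.coeff m)
    (σ : Equiv.Perm (Fin n)) (i j : Fin n) :
    (φ.totalDegree ≤ 1 →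
      |permEval n φ σ - permEval n φ (σ * Equiv.swap i j)| ≤ 2 * gradNorm n φ) ∧
    |permEval n φ σ - permEval n φ (σ * Equiv.swap i j)| ≤ 6 * gradNorm n φ := by
  have hle := permEval_sub_le_two_mul_gradNorm n φ hpos σ i j
  have hge := permEval_sub_le_two_mul_gradNorm n φ hpos (σ * Equiv.swap i j) i j
  rw [mul_assoc, Equiv.swap_mul_self, mul_one] at hge
  have habs : |permEval n φ σ - permEval n φ (σ * Equiv.swap i j)| ≤ 2 * gradNorm n φ :=
    abs_le.mpr ⟨by linarith, hle⟩
  have hnn : 0 ≤ gradNorm n φ :=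
    (abs_nonneg _).trans (abs_permEval_pderiv_le_gradNorm n φ σ (i, j))
  exact ⟨fun _ => habs, by linarith⟩
end
end

section
/- Self-bounding inequality for the absolute random transposition increment: Let φ be a homogeneous multilinear polynomial of degree d ≥ 1 in the indeterminates X_{ij}, i,j ∈ [n], with non-negative coefficients. Let τ = (I J), where I and J are independent uniform random indices in [n] (τ = identity if I = J). Then for every permutation σ of [n]: (n/(2d)) · E_{I,J}[ |φ(σ) − φ(στ)| ] ≤ (1 − (d−1)/(2n))·φ(σ) + Dφ(σ) + Uφ(σ). -/
open MvPolynomial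

noncomputable section

/-- `Dφ(σ)` for a homogeneous `φ` of degree `d`:
`(1/(dn)) ∑_{i,j} ∂_{ij}φ(σ)`. -/
def Dhom (n d : ℕ) (φ : MvPolynomial (Fin n × Fin n) ℝ) (σ : Equiv.Perm (Fin n)) : ℝ :=
  (1 / ((d : ℝ) * (n : ℝ))) * ∑ i : Fin n, ∑ j : Fin n, permEval n (pderiv (i, j) φ) σ

/-- `Uφ(σ)` for a homogeneous `φ` of degree `d`:
`(1/(dn)) ∑_{i,j,k,l} X_{il}(σ) X_{kj}(σ) ∂_{ij}∂_{kl}φ(σ)`. -/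
def Uhom (n d : ℕ) (φ : MvPolynomial (Fin n × Fin n) ℝ) (σ : Equiv.Perm (Fin n)) : ℝ :=
  (1 / ((d : ℝ) * (n : ℝ))) * ∑ i : Fin n, ∑ j : Fin n, ∑ k : Fin n, ∑ l : Fin n,
    permMat n σ (i, l) * permMat n σ (k, j) *
      permEval n (pderiv (i, j) (pderiv (k, l) φ)) σ

/-- The squarefree monomial `∏_{p ∈ s} X_p`. -/
def sqfreeMonomial {n : ℕ} (s : Finset (Fin n × Fin n)) : MvPolynomial (Fin n × Fin n) ℝ :=
  ∏ p ∈ s, X p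

lemma pderiv_sqfreeMonomial {n : ℕ} (s : Finset (Fin n × Fin n)) (p : Fin n × Fin n) :
    pderiv p (sqfreeMonomial s) = if p ∈ s then sqfreeMonomial (s.erase p) else 0 := by
  have h0 : ∀ t : Finset (Fin n × Fin n), p ∉ t → pderiv p (sqfreeMonomial t) = 0 := by
    intro t
    induction t using Finset.induction_on with
    | empty => simp [sqfreeMonomial]
    | insert a t ha ih =>
      intro hp
      rw [Finset.mem_insert, not_or] at hp
      have ht := ih hp.2
      rw [sqfreeMonomial] at ht ⊢
      rw [Finset.prod_insert ha, pderiv_mul, ht, pderiv_X_of_ne (Ne.symm hp.1), zero_mul,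
        mul_zero, add_zero]
  split_ifs with hp
  · have hs : sqfreeMonomial s = X p * sqfreeMonomial (s.erase p) :=
      (Finset.mul_prod_erase s _ hp).symm
    rw [hs, pderiv_mul, h0 _ (Finset.notMem_erase p s), pderiv_X_self, one_mul, mul_zero, add_zero]
  · exact h0 s hp

lemma permEval_sqfreeMonomial {n : ℕ} (s : Finset (Fin n × Fin n)) (σ : Equiv.Perm (Fin n)) :
    permEval n (sqfreeMonomial s) σ = if ∀ p ∈ s, σ p.1 = p.2 then 1 else 0 := by
  unfold permEval sqfreeMonomial
  simp only [map_prod, eval_X, permMat, Finset.prod_boole]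
  congr

lemma permEval_pderiv_sqfreeMonomial_nonneg {n : ℕ} (s : Finset (Fin n × Fin n))
    (p : Fin n × Fin n) (σ : Equiv.Perm (Fin n)) :
    0 ≤ permEval n (pderiv p (sqfreeMonomial s)) σ := by
  rw [pderiv_sqfreeMonomial]
  split_ifs
  · rw [permEval_sqfreeMonomial]
    positivity
  · simp [permEval]

lemma permEval_pderiv_pderiv_sqfreeMonomial_nonneg {n : ℕ} (s : Finset (Fin n × Fin n))
    (p q : Fin n × Fin n) (σ : Equiv.Perm (Fin n)) :
    0 ≤ permEval n (pderiv p (pderiv q (sqfreeMonomial s))) σ := by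
  rw [pderiv_sqfreeMonomial]
  split_ifs
  · exact permEval_pderiv_sqfreeMonomial_nonneg _ _ _
  · simp [permEval]

/-- The sum in `Uhom` only runs over the pairs `i, k`, with `l = σ i` and `j = σ k`. -/
lemma sum_permMat_mul_permMat_mul {n : ℕ} (σ : Equiv.Perm (Fin n))
    (f : Fin n → Fin n → Fin n → Fin n → ℝ) :
    ∑ i, ∑ j, ∑ k, ∑ l, permMat n σ (i, l) * permMat n σ (k, j) * f i j k l =
      ∑ i, ∑ k, f i (σ k) k (σ i) := by
  refine Finset.sum_congr rfl fun i _ => ?_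
  rw [Finset.sum_comm]
  refine Finset.sum_congr rfl fun k _ => ?_
  simp [permMat, ite_mul]

/-- A squarefree monomial that vanishes at `σ` and not at `σ * swap I J` is counted by one of
its derivatives at `σ`. -/
lemma permEval_mul_swap_sqfreeMonomial_le {n : ℕ} (s : Finset (Fin n × Fin n))
    (σ : Equiv.Perm (Fin n)) (h : ¬ ∀ p ∈ s, σ p.1 = p.2) (I J : Fin n) :
    permEval n (sqfreeMonomial s) (σ * Equiv.swap I J) ≤
      permEval n (pderiv (I, σ J) (sqfreeMonomial s)) σ +
      permEval n (pderiv (J, σ I) (sqfreeMonomial s)) σ +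
      permEval n (pderiv (I, σ J) (pderiv (J, σ I) (sqfreeMonomial s))) σ := by
  have h₁ := permEval_pderiv_sqfreeMonomial_nonneg s (I, σ J) σ
  have h₂ := permEval_pderiv_sqfreeMonomial_nonneg s (J, σ I) σ
  have h₃ := permEval_pderiv_pderiv_sqfreeMonomial_nonneg s (I, σ J) (J, σ I) σ
  rw [permEval_sqfreeMonomial]
  split_ifs with hs
  swap
  · positivity
  have hIJ : I ≠ J := by
    rintro rfl
    exact h (by simpa using hs)
  have key : ∀ p ∈ s, p ≠ (I, σ J) → p ≠ (J, σ I) → σ p.1 = p.2 := by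
    rintro ⟨a, b⟩ hp hI hJ
    have hab := hs _ hp
    simp only [Equiv.Perm.mul_apply] at hab
    by_cases haI : a = I
    · subst haI
      simp_all
    by_cases haJ : a = J
    · subst haJ
      simp_all
    simpa [Equiv.swap_apply_of_ne_of_ne haI haJ] using hab
  by_cases hI : (I, σ J) ∈ s <;> by_cases hJ : (J, σ I) ∈ s
  · have : permEval n (pderiv (I, σ J) (pderiv (J, σ I) (sqfreeMonomial s))) σ = 1 := by
      rw [pderiv_sqfreeMonomial, if_pos hJ, pderiv_sqfreeMonomial, if_pos (by simp [hI, hIJ]),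
        permEval_sqfreeMonomial, if_pos]
      intro p hp
      simp only [Finset.mem_erase] at hp
      exact key p hp.2.2 hp.1 hp.2.1
    linarith
  · have : permEval n (pderiv (I, σ J) (sqfreeMonomial s)) σ = 1 := by
      rw [pderiv_sqfreeMonomial, if_pos hI, permEval_sqfreeMonomial, if_pos]
      intro p hp
      rw [Finset.mem_erase] at hp
      exact key p hp.2 hp.1 (ne_of_mem_of_not_mem hp.2 hJ)
    linarith
  · have : permEval n (pderiv (J, σ I) (sqfreeMonomial s)) σ = 1 := by
      rw [pderiv_sqfreeMonomial, if_pos hJ, permEval_sqfreeMonomial, if_pos]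
      intro p hp
      rw [Finset.mem_erase] at hp
      exact key p hp.2 (ne_of_mem_of_not_mem hp.2 hI) hp.1
    linarith
  · exact absurd (fun p hp => key p hp (ne_of_mem_of_not_mem hp hI)
      (ne_of_mem_of_not_mem hp hJ)) h

/-- A squarefree monomial that does not vanish at `σ` vanishes at `σ * swap I J` only if one of
`I`, `J` is a row of the monomial. -/
lemma sum_one_sub_permEval_mul_swap_le {n : ℕ} (s : Finset (Fin n × Fin n))
    (σ : Equiv.Perm (Fin n)) (h : ∀ p ∈ s, σ p.1 = p.2) :
    ∑ I, ∑ J, (1 - permEval n (sqfreeMonomial s) (σ * Equiv.swap I J)) ≤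
      (s.card : ℝ) * (2 * n - s.card) := by
  set A := s.image Prod.fst with hA
  have hcard : A.card = s.card := by
    refine Finset.card_image_of_injOn fun p hp q hq hpq => Prod.ext hpq ?_
    rw [← h p hp, ← h q hq, hpq]
  let g : Fin n → ℝ := fun i => if i ∈ A then 0 else 1
  have hg : ∑ i, g i = n - s.card := by
    have hg' : ∀ i, g i = 1 - if i ∈ A then 1 else 0 := fun i => by
      simp only [g]
      split_ifs <;> simp
    simp [hg', hcard]
  have hle : ∀ I J, 1 - permEval n (sqfreeMonomial s) (σ * Equiv.swap I J) ≤ 1 - g I * g J := by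
    intro I J
    rw [permEval_sqfreeMonomial]
    by_cases hI : I ∈ A
    · simp only [g, if_pos hI]
      split_ifs <;> simp
    by_cases hJ : J ∈ A
    · simp only [g, if_pos hJ]
      split_ifs <;> simp
    rw [if_pos]
    · simp [g, hI, hJ]
    intro p hp
    have hpA : p.1 ∈ A := Finset.mem_image_of_mem _ hp
    rw [Equiv.Perm.mul_apply, Equiv.swap_apply_of_ne_of_ne (ne_of_mem_of_not_mem hpA hI)
      (ne_of_mem_of_not_mem hpA hJ), h p hp]
  calc _ ≤ ∑ I, ∑ J, (1 - g I * g J) :=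
        Finset.sum_le_sum fun I _ => Finset.sum_le_sum fun J _ => hle I J
    _ = (n : ℝ) * n - (∑ I, g I) * ∑ J, g J := by
        simp [Finset.sum_sub_distrib, Finset.sum_mul_sum]
    _ = _ := by
        rw [hg]
        ring

lemma sum_abs_permEval_sub_sqfreeMonomial_le {n : ℕ} (s : Finset (Fin n × Fin n))
    (σ : Equiv.Perm (Fin n)) :
    ∑ I, ∑ J, |permEval n (sqfreeMonomial s) σ -
        permEval n (sqfreeMonomial s) (σ * Equiv.swap I J)| ≤
      (s.card : ℝ) * (2 * n - s.card) * permEval n (sqfreeMonomial s) σ +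
      2 * ∑ i, ∑ j, permEval n (pderiv (i, j) (sqfreeMonomial s)) σ +
      ∑ i, ∑ k, permEval n (pderiv (i, σ k) (pderiv (k, σ i) (sqfreeMonomial s))) σ := by
  have hD : 0 ≤ ∑ i, ∑ j, permEval n (pderiv (i, j) (sqfreeMonomial s)) σ :=
    Finset.sum_nonneg fun i _ => Finset.sum_nonneg fun j _ =>
      permEval_pderiv_sqfreeMonomial_nonneg _ _ _
  have hU : 0 ≤ ∑ i, ∑ k,
      permEval n (pderiv (i, σ k) (pderiv (k, σ i) (sqfreeMonomial s))) σ :=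
    Finset.sum_nonneg fun i _ => Finset.sum_nonneg fun k _ =>
      permEval_pderiv_pderiv_sqfreeMonomial_nonneg _ _ _ _
  by_cases h : ∀ p ∈ s, σ p.1 = p.2
  · have h1 : permEval n (sqfreeMonomial s) σ = 1 := by
      rw [permEval_sqfreeMonomial, if_pos h]
    have habs : ∀ I J, |1 - permEval n (sqfreeMonomial s) (σ * Equiv.swap I J)| =
        1 - permEval n (sqfreeMonomial s) (σ * Equiv.swap I J) := fun I J => by
      rw [permEval_sqfreeMonomial]
      split_ifs <;> simp
    simp only [h1, habs]
    linarith [sum_one_sub_permEval_mul_swap_le s σ h]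
  · have h0 : permEval n (sqfreeMonomial s) σ = 0 := by
      rw [permEval_sqfreeMonomial, if_neg h]
    have habs : ∀ I J, |0 - permEval n (sqfreeMonomial s) (σ * Equiv.swap I J)| =
        permEval n (sqfreeMonomial s) (σ * Equiv.swap I J) := fun I J => by
      rw [permEval_sqfreeMonomial]
      split_ifs <;> simp
    simp only [h0, habs]
    have hrow : ∀ i, ∑ k, permEval n (pderiv (i, σ k) (sqfreeMonomial s)) σ =
        ∑ j, permEval n (pderiv (i, j) (sqfreeMonomial s)) σ := fun i =>
      Equiv.sum_comp σ fun j => permEval n (pderiv (i, j) (sqfreeMonomial s)) σ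
    have hsum := Finset.sum_le_sum fun I (_ : I ∈ Finset.univ) =>
      Finset.sum_le_sum fun J (_ : J ∈ Finset.univ) =>
        permEval_mul_swap_sqfreeMonomial_le s σ h I J
    simp only [Finset.sum_add_distrib] at hsum
    rw [Finset.sum_comm (f := fun I J => permEval n (pderiv (J, σ I) (sqfreeMonomial s)) σ)]
      at hsum
    simp only [hrow] at hsum
    linarith

/-- The exponents of a polynomial `φ` with `∂_p ∂_p φ = 0` for all `p` are at most one. -/
lemma IsMultilinear.exponent_eq_one {n : ℕ} {φ : MvPolynomial (Fin n × Fin n) ℝ}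
    (hml : IsMultilinear n φ) {m : Fin n × Fin n →₀ ℕ} (hm : m ∈ φ.support)
    {p : Fin n × Fin n} (hp : p ∈ m.support) : m p = 1 := by
  by_contra hne
  have h2 : 2 ≤ m p := by
    have := Finsupp.mem_support_iff.mp hp
    omega
  obtain ⟨m', rfl⟩ := exists_add_of_le (Finsupp.single_le_iff.mpr h2)
  have h0 := congrArg (coeff m') (hml p.1 p.2 p.2).1
  have hadd : m' + Finsupp.single p 1 + Finsupp.single p 1 = Finsupp.single p 2 + m' := by
    rw [add_assoc, ← Finsupp.single_add, add_comm]
  rw [coeff_pderiv, coeff_pderiv, hadd, coeff_zero] at h0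
  have h₁ : (m' p : ℝ) + 1 ≠ 0 := by positivity
  have h₂ : ((m' p : ℝ) + 1) + 1 ≠ 0 := by positivity
  exact mem_support_iff.mp hm (by simpa [h₁, h₂] using h0)

lemma IsMultilinear.monomial_eq_smul {n : ℕ} {φ : MvPolynomial (Fin n × Fin n) ℝ}
    (hml : IsMultilinear n φ) {m : Fin n × Fin n →₀ ℕ} (hm : m ∈ φ.support) :
    monomial m (φ.coeff m) = φ.coeff m • sqfreeMonomial m.support := by
  rw [monomial_eq, smul_eq_C_mul, sqfreeMonomial, Finsupp.prod]
  congr 1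
  exact Finset.prod_congr rfl fun p hp => by rw [hml.exponent_eq_one hm hp, pow_one]

lemma permEval_add {n : ℕ} (φ ψ : MvPolynomial (Fin n × Fin n) ℝ) (σ : Equiv.Perm (Fin n)) :
    permEval n (φ + ψ) σ = permEval n φ σ + permEval n ψ σ := map_add _ _ _

lemma permEval_smul {n : ℕ} (c : ℝ) (φ : MvPolynomial (Fin n × Fin n) ℝ)
    (σ : Equiv.Perm (Fin n)) : permEval n (c • φ) σ = c * permEval n φ σ := smul_eval _ _ _

lemma permEval_nonneg {n : ℕ} {φ : MvPolynomial (Fin n × Fin n) ℝ} (hφ : ∀ m, 0 ≤ φ.coeff m)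
    (σ : Equiv.Perm (Fin n)) : 0 ≤ permEval n φ σ := by
  rw [permEval, eval_eq]
  refine Finset.sum_nonneg fun m _ => mul_nonneg (hφ m) (Finset.prod_nonneg fun p _ => ?_)
  unfold permMat
  positivity

lemma coeff_pderiv_nonneg {n : ℕ} {φ : MvPolynomial (Fin n × Fin n) ℝ}
    (hφ : ∀ m, 0 ≤ φ.coeff m) (p : Fin n × Fin n) (m : Fin n × Fin n →₀ ℕ) :
    0 ≤ (pderiv p φ).coeff m := by
  rw [coeff_pderiv]
  exact mul_nonneg (hφ _) (by positivity)

/-- The bound for squarefree monomials passes to non-negative combinations of them. -/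
lemma sum_abs_permEval_sub_le {n d : ℕ} {φ : MvPolynomial (Fin n × Fin n) ℝ}
    (hml : IsMultilinear n φ) (hhom : φ.IsHomogeneous d) (hpos : ∀ m, 0 ≤ φ.coeff m)
    (σ : Equiv.Perm (Fin n)) :
    ∑ I, ∑ J, |permEval n φ σ - permEval n φ (σ * Equiv.swap I J)| ≤
      (d : ℝ) * (2 * n - d) * permEval n φ σ +
      2 * ∑ i, ∑ j, permEval n (pderiv (i, j) φ) σ +
      ∑ i, ∑ k, permEval n (pderiv (i, σ k) (pderiv (k, σ i) φ)) σ := by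
  let P : MvPolynomial (Fin n × Fin n) ℝ → Prop := fun φ =>
    ∑ I, ∑ J, |permEval n φ σ - permEval n φ (σ * Equiv.swap I J)| ≤
      (d : ℝ) * (2 * n - d) * permEval n φ σ +
      2 * ∑ i, ∑ j, permEval n (pderiv (i, j) φ) σ +
      ∑ i, ∑ k, permEval n (pderiv (i, σ k) (pderiv (k, σ i) φ)) σ
  have hadd : ∀ φ ψ, P φ → P ψ → P (φ + ψ) := by
    intro φ ψ hφ hψ
    simp only [P, permEval_add, map_add, Finset.sum_add_distrib] at hφ hψ ⊢
    have := Finset.sum_le_sum fun I (_ : I ∈ Finset.univ) =>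
      Finset.sum_le_sum fun J (_ : J ∈ Finset.univ) =>
        abs_add_le (permEval n φ σ - permEval n φ (σ * Equiv.swap I J))
          (permEval n ψ σ - permEval n ψ (σ * Equiv.swap I J))
    simp only [Finset.sum_add_distrib] at this
    simp only [add_sub_add_comm]
    linarith
  have hsmul : ∀ c : ℝ, 0 ≤ c → ∀ φ, P φ → P (c • φ) := by
    intro c hc φ hφ
    simp only [P, permEval_smul, Derivation.map_smul, ← mul_sub, abs_mul, abs_of_nonneg hc,
      ← Finset.mul_sum] at hφ ⊢
    linarith [mul_le_mul_of_nonneg_left hφ hc]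
  change P φ
  rw [φ.as_sum]
  refine Finset.sum_induction _ P hadd (by simp [P, permEval]) fun m hm => ?_
  have hcard : m.support.card = d := by
    rw [← hhom (mem_support_iff.mp hm), Pi.one_def, Finsupp.weight_apply, Finsupp.sum,
      Finset.card_eq_sum_ones]
    exact Finset.sum_congr rfl fun p hp => by simp [hml.exponent_eq_one hm hp]
  rw [hml.monomial_eq_smul hm]
  refine hsmul _ (hpos m) _ ?_
  simpa only [hcard] using sum_abs_permEval_sub_sqfreeMonomial_le m.support σ

/-- Lemma 9.5 (ii): self-bounding inequality for the absolute random transposition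
increment of a homogeneous multilinear function with non-negative coefficients. -/
theorem transposition_increment_self_bounding (n d : ℕ) (hn : 1 ≤ n) (hd : 1 ≤ d)
    (φ : MvPolynomial (Fin n × Fin n) ℝ)
    (hml : IsMultilinear n φ) (hhom : φ.IsHomogeneous d)
    (hpos : ∀ m, 0 ≤ φ.coeff m)
    (σ : Equiv.Perm (Fin n)) :
    ((n : ℝ) / (2 * (d : ℝ))) *
        ((∑ I : Fin n, ∑ J : Fin n,
          |permEval n φ σ - permEval n φ (σ * Equiv.swap I J)|) / ((n : ℝ) ^ 2)) ≤
      (1 - ((d : ℝ) - 1) / (2 * (n : ℝ))) * permEval n φ σ +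
        Dhom n d φ σ + Uhom n d φ σ := by
  have hn' : (0 : ℝ) < n := by exact_mod_cast hn
  have hd' : (0 : ℝ) < d := by exact_mod_cast hd
  have key := sum_abs_permEval_sub_le hml hhom hpos σ
  have hU : 0 ≤ ∑ i, ∑ k, permEval n (pderiv (i, σ k) (pderiv (k, σ i) φ)) σ :=
    Finset.sum_nonneg fun i _ => Finset.sum_nonneg fun k _ =>
      permEval_nonneg (coeff_pderiv_nonneg (coeff_pderiv_nonneg hpos _) _) σ
  have hφ : 0 ≤ (d : ℝ) * permEval n φ σ := mul_nonneg hd'.le (permEval_nonneg hpos σ)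
  rw [Dhom, Uhom, sum_permMat_mul_permMat_mul σ fun i j k l =>
    permEval n (pderiv (i, j) (pderiv (k, l) φ)) σ]
  set u := ∑ i, ∑ k, permEval n (pderiv (i, σ k) (pderiv (k, σ i) φ)) σ
  set D := ∑ i, ∑ j, permEval n (pderiv (i, j) φ) σ
  set a := ∑ I, ∑ J, |permEval n φ σ - permEval n φ (σ * Equiv.swap I J)|
  set e := permEval n φ σ
  calc (n : ℝ) / (2 * d) * (a / (n : ℝ) ^ 2) = a / (2 * d * n) := by field_simp
    _ ≤ (d * (2 * n - d + 1) * e + 2 * D + 2 * u) / (2 * d * n) := by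
        gcongr
        linarith
    _ = _ := by
        field_simp
        ring
end
end
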